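/- arXiv:2511.03953 — 8 statements merged into one kernel-verified Lean document; each statement's English description precedes it below -/
import Mathlib

section
/- Let X be a measurable space and let κ be a Markov (probability) kernel on X satisfying Doeblin's condition: there exist a probability measure φ on X, a constant λ > 0, and an integer l ≥ 1 such that κ^l(x, A) ≥ λ·φ(A) for every x ∈ X and every measurable A ⊆ X. Define the pair kernel κ̃ on X × X by κ̃((x, y), C) = ∫ 1_C(y, z) κ(y, dz), i.e. from state (x, y) the chain moves to (y, Z) with Z ~ κ(y, ·). Then κ̃ also satisfies Doeblin's condition: for every (x, y) ∈ X × X and every measurable C ⊆ X × X, κ̃^{l+1}((x, y), C) ≥ λ·ν(C), where ν is the probability measure on X × X given by ν(C) = ∫∫ 1_C(u, z) κ(u, dz) φ(du). -/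
open MeasureTheory ProbabilityTheory
open scoped ENNReal NNReal

/-- Iterates of a Markov kernel: `kernelIter κ n` is the `n`-step transition kernel. -/
noncomputable def kernelIter {X : Type*} [MeasurableSpace X]
    (κ : Kernel X X) : ℕ → Kernel X X
  | 0 => Kernel.id
  | n + 1 => κ ∘ₖ kernelIter κ n

/-- The pair kernel on `X × X`: from state `(x, y)` the chain moves to `(y, Z)` with
`Z ~ κ(y, ·)`. -/
noncomputable def pairKernel {X : Type*} [MeasurableSpace X]
    (κ : Kernel X X) [IsSFiniteKernel κ] : Kernel (X × X) (X × X) :=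
  (Kernel.id ×ₖ κ).comap Prod.snd measurable_snd

lemma pairKernel_apply {X : Type*} [MeasurableSpace X] (κ : Kernel X X) [IsSFiniteKernel κ]
    (p : X × X) {C : Set (X × X)} (hC : MeasurableSet C) :
    pairKernel κ p C = κ p.2 (Prod.mk p.2 ⁻¹' C) := by
  rw [pairKernel, Kernel.comap_apply, Kernel.id_prod_apply' _ _ hC]

lemma map_snd_pairKernel {X : Type*} [MeasurableSpace X] (κ : Kernel X X) [IsSFiniteKernel κ]
    (p : X × X) : (pairKernel κ p).map Prod.snd = κ p.2 := by
  ext A hA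
  rw [Measure.map_apply measurable_snd hA, pairKernel_apply κ p (measurable_snd hA)]
  rfl

/-- The second coordinate of the pair chain evolves according to the original kernel. -/
lemma lintegral_snd_kernelIter_pairKernel {X : Type*} [MeasurableSpace X] (κ : Kernel X X)
    [IsSFiniteKernel κ] (n : ℕ) (p : X × X) {f : X → ℝ≥0∞} (hf : Measurable f) :
    ∫⁻ q, f q.2 ∂(kernelIter (pairKernel κ) n p) = ∫⁻ u, f u ∂(kernelIter κ n p.2) := by
  have hf2 : Measurable fun q : X × X => f q.2 := hf.comp measurable_snd
  induction n generalizing f with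
  | zero =>
    simp only [kernelIter, Kernel.id_apply]
    rw [lintegral_dirac' _ hf2, lintegral_dirac' _ hf]
  | succ n ih =>
    simp only [kernelIter]
    rw [Kernel.lintegral_comp _ _ _ hf2, Kernel.lintegral_comp _ _ _ hf,
      ← ih hf.lintegral_kernel (hf.lintegral_kernel.comp measurable_snd)]
    refine lintegral_congr fun q => ?_
    rw [← map_snd_pairKernel κ q, lintegral_map hf measurable_snd]

/-- If a Markov kernel `κ` satisfies Doeblin's condition with constants `(l, lam)` and
minorizing probability measure `φ`, then the pair kernel also satisfies Doeblin's
condition, with constants `(l + 1, lam)` and minorizing probability measure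
`ν = φ ⊗ₘ κ` given by `ν C = ∫∫ 1_C (u, z) κ(u, dz) φ(du)`. -/
theorem pairKernel_doeblin {X : Type*} [MeasurableSpace X]
    (κ : Kernel X X) [IsMarkovKernel κ]
    (φ : Measure X) [IsProbabilityMeasure φ] (lam : ℝ≥0) (l : ℕ)
    (hlam : 0 < lam) (hl : 1 ≤ l)
    (hDoeblin : ∀ x : X, ∀ A : Set X, MeasurableSet A →
      (lam : ℝ≥0∞) * φ A ≤ kernelIter κ l x A) :
    ∀ p : X × X, ∀ C : Set (X × X), MeasurableSet C →
      (lam : ℝ≥0∞) * (φ ⊗ₘ κ) C ≤ kernelIter (pairKernel κ) (l + 1) p C := by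
  intro p C hC
  have hmeas : Measurable fun u => κ u (Prod.mk u ⁻¹' C) :=
    Kernel.measurable_kernel_prodMk_left hC
  have hle : (lam : ℝ≥0∞) • φ ≤ kernelIter κ l p.2 :=
    Measure.le_iff.2 fun A hA => by simpa using hDoeblin p.2 A hA
  calc (lam : ℝ≥0∞) * (φ ⊗ₘ κ) C
      = ∫⁻ u, κ u (Prod.mk u ⁻¹' C) ∂((lam : ℝ≥0∞) • φ) := by
        rw [Measure.compProd_apply hC, lintegral_smul_measure, smul_eq_mul]
    _ ≤ ∫⁻ u, κ u (Prod.mk u ⁻¹' C) ∂(kernelIter κ l p.2) := lintegral_mono' hle le_rfl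
    _ = ∫⁻ q, κ q.2 (Prod.mk q.2 ⁻¹' C) ∂(kernelIter (pairKernel κ) l p) :=
        (lintegral_snd_kernelIter_pairKernel κ l p hmeas).symm
    _ = kernelIter (pairKernel κ) (l + 1) p C := by
        rw [kernelIter, Kernel.comp_apply' _ _ _ hC]
        exact lintegral_congr fun q => (pairKernel_apply κ q hC).symm
end

section
/- Let X be a standard Borel space and κ a Markov kernel on X satisfying Doeblin's condition with constants (l, λ) and minorizing probability measure φ: κ^l(x, ·) ≥ λ·φ(·) for all x. Let {X_t}_{t≥0} be the Markov chain with transition kernel κ started from an arbitrary initial distribution (its law being the trajectory measure ℙ on the sequence space given by the Ionescu–Tulcea construction). Let f : X → ℝ be a bounded measurable function with ‖f‖ = sup_x |f(x)| < ∞, set S_n = Σ_{t=1}^n f(X_t) and μ_f = 2(l+1)‖f‖/λ. Then for every ε > 0 and every integer n > μ_f/ε, ℙ(|S_n − 𝔼[S_n]| ≥ nε) ≤ 2·exp(−2(nε − μ_f)² / (n·μ_f²)). -/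
open MeasureTheory ProbabilityTheory
open scoped ENNReal NNReal

section Oscillation

variable {α : Type*} [MeasurableSpace α]

lemma integrable_of_measurable_of_abs_le (μ : Measure α) [IsFiniteMeasure μ] {h : α → ℝ}
    (hm : Measurable h) {C : ℝ} (hC : ∀ x, |h x| ≤ C) : Integrable h μ :=
  Integrable.of_bound hm.aestronglyMeasurable C (ae_of_all _ hC)

lemma abs_integral_le_of_abs_le (μ : Measure α) [IsProbabilityMeasure μ] {h : α → ℝ}
    {C : ℝ} (hC : ∀ x, |h x| ≤ C) : |∫ x, h x ∂μ| ≤ C := by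
  simpa using norm_integral_le_of_norm_le_const (μ := μ) (f := h) (C := C) (ae_of_all _ hC)

/-- A function of oscillation at most `R` has integrals differing by at most `(1 - c) * R`
under two probability measures which dominate a common measure of mass `c`. -/
lemma integral_sub_integral_le_of_smul_le (μ ν φ : Measure α) [IsProbabilityMeasure μ]
    [IsProbabilityMeasure ν] [IsProbabilityMeasure φ] {c : ℝ≥0} (hμ : c • φ ≤ μ) (hν : c • φ ≤ ν)
    {h : α → ℝ} (hm : Measurable h) {C : ℝ} (hC : ∀ x, |h x| ≤ C)
    {R : ℝ} (hR : ∀ x y, h x - h y ≤ R) :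
    ∫ x, h x ∂μ - ∫ x, h x ∂ν ≤ (1 - c) * R := by
  have : Nonempty α := nonempty_of_isProbabilityMeasure μ
  have hbdd : BddBelow (Set.range h) := ⟨-C, by
    rintro _ ⟨x, rfl⟩; exact (abs_le.1 (hC x)).1⟩
  set a : ℝ := ⨅ x, h x
  have ha : ∀ x, a ≤ h x := fun x => ciInf_le hbdd x
  have hb : ∀ x, h x ≤ a + R := fun x => by
    have : h x - R ≤ a := le_ciInf fun y => by linarith [hR x y]
    linarith
  have hi : ∀ (ρ : Measure α) [IsProbabilityMeasure ρ], Integrable h ρ := fun ρ _ =>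
    integrable_of_measurable_of_abs_le ρ hm hC
  have h1 := integral_mono_measure (f := fun x => a + R - h x) hμ
    (ae_of_all _ fun x => sub_nonneg.2 (hb x)) ((integrable_const _).sub (hi μ))
  have h2 := integral_mono_measure (f := fun x => h x - a) hν
    (ae_of_all _ fun x => sub_nonneg.2 (ha x)) ((hi ν).sub (integrable_const _))
  rw [integral_smul_nnreal_measure, integral_sub (integrable_const _) (hi _),
    integral_sub (integrable_const _) (hi _)] at h1
  rw [integral_smul_nnreal_measure, integral_sub (hi _) (integrable_const _),
    integral_sub (hi _) (integrable_const _)] at h2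
  simp only [integral_const, probReal_univ, smul_eq_mul, one_mul, NNReal.smul_def] at h1 h2
  linarith

lemma integral_sub_integral_le (μ ν : Measure α) [IsProbabilityMeasure μ]
    [IsProbabilityMeasure ν] {h : α → ℝ} (hm : Measurable h) {C : ℝ} (hC : ∀ x, |h x| ≤ C)
    {R : ℝ} (hR : ∀ x y, h x - h y ≤ R) :
    ∫ x, h x ∂μ - ∫ x, h x ∂ν ≤ R := by
  simpa using integral_sub_integral_le_of_smul_le μ ν μ (c := 0)
    (by rw [zero_smul]; exact Measure.zero_le μ) (by rw [zero_smul]; exact Measure.zero_le ν) hm hC hR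

end Oscillation

section KernelAction

variable {α : Type*} [MeasurableSpace α] (κ : Kernel α α)

instance isMarkovKernel_kernelIter [IsMarkovKernel κ] (n : ℕ) :
    IsMarkovKernel (kernelIter κ n) := by
  induction n with
  | zero => rw [kernelIter]; infer_instance
  | succ n ih => rw [kernelIter]; infer_instance

/-- The action of a kernel on real functions. -/
noncomputable def kernelAct (h : α → ℝ) (x : α) : ℝ := ∫ y, h y ∂κ x

/-- The partial sums `∑_{j < n} κ ^ j f`. -/
noncomputable def kernelSum (f : α → ℝ) : ℕ → α → ℝ
  | 0 => 0
  | n + 1 => f + kernelAct κ (kernelSum f n)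

/-- Bounded measurable functions. -/
def BddMeasurable (h : α → ℝ) : Prop := Measurable h ∧ ∃ C, ∀ x, |h x| ≤ C

variable {κ} {f g h : α → ℝ}

lemma BddMeasurable.add (hg : BddMeasurable g) (hh : BddMeasurable h) :
    BddMeasurable (g + h) := by
  obtain ⟨hg, C, hC⟩ := hg
  obtain ⟨hh, D, hD⟩ := hh
  exact ⟨hg.add hh, C + D, fun x => (abs_add_le _ _).trans (add_le_add (hC x) (hD x))⟩

lemma BddMeasurable.integrable (hh : BddMeasurable h) (μ : Measure α) [IsFiniteMeasure μ] :
    Integrable h μ :=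
  let ⟨hm, _, hC⟩ := hh
  integrable_of_measurable_of_abs_le μ hm hC

variable [IsMarkovKernel κ]

lemma BddMeasurable.kernelAct (hh : BddMeasurable h) : BddMeasurable (kernelAct κ h) := by
  obtain ⟨hm, C, hC⟩ := hh
  exact ⟨(StronglyMeasurable.integral_kernel hm.stronglyMeasurable).measurable, C,
    fun x => abs_integral_le_of_abs_le _ hC⟩

lemma BddMeasurable.kernelAct_iterate (hh : BddMeasurable h) (n : ℕ) :
    BddMeasurable ((_root_.kernelAct κ)^[n] h) := by
  induction n with
  | zero => exact hh
  | succ n ih => rw [Function.iterate_succ_apply']; exact ih.kernelAct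

lemma BddMeasurable.kernelSum (hf : BddMeasurable f) (n : ℕ) :
    BddMeasurable (kernelSum κ f n) := by
  induction n with
  | zero => exact ⟨measurable_const, 0, by simp [_root_.kernelSum]⟩
  | succ n ih => exact hf.add ih.kernelAct

lemma kernelAct_add (hg : BddMeasurable g) (hh : BddMeasurable h) :
    kernelAct κ (g + h) = kernelAct κ g + kernelAct κ h := by
  ext x
  exact integral_add (hg.integrable _) (hh.integrable _)

lemma kernelSum_add (hf : BddMeasurable f) (j m : ℕ) :
    kernelSum κ f (j + m) = kernelSum κ f j + (kernelAct κ)^[j] (kernelSum κ f m) := by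
  induction j with
  | zero => simp [kernelSum]
  | succ j ih =>
    rw [Nat.succ_add_eq_add_succ, Nat.add_succ, kernelSum, ih,
      kernelAct_add (hf.kernelSum j) ((hf.kernelSum m).kernelAct_iterate j), kernelSum,
      Function.iterate_succ_apply', add_assoc]

lemma kernelAct_iterate (hh : BddMeasurable h) (n : ℕ) (x : α) :
    (kernelAct κ)^[n] h x = ∫ y, h y ∂kernelIter κ n x := by
  induction n generalizing h with
  | zero =>
    rw [kernelIter, Kernel.id_apply, integral_dirac' _ _ hh.1.stronglyMeasurable]
    rfl
  | succ n ih =>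
    rw [Function.iterate_succ_apply, ih hh.kernelAct, kernelIter,
      Kernel.integral_comp (hh.integrable _)]
    rfl

lemma abs_kernelSum_le {M : ℝ} (hM : ∀ x, |f x| ≤ M) (n : ℕ) (x : α) :
    |kernelSum κ f n x| ≤ n * M := by
  induction n generalizing x with
  | zero => simp [kernelSum]
  | succ n ih =>
    calc |kernelSum κ f (n + 1) x| ≤ |f x| + |kernelAct κ (kernelSum κ f n) x| := abs_add_le _ _
      _ ≤ M + n * M := add_le_add (hM x) (abs_integral_le_of_abs_le _ ih)
      _ = (n + 1 : ℕ) * M := by push_cast; ring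

/-- Under Doeblin's condition the partial sums `∑_{j < n} κ ^ j f` have uniformly bounded
oscillation. -/
lemma kernelSum_sub_le (φ : Measure α) [IsProbabilityMeasure φ] {c : ℝ≥0} {l : ℕ}
    (hc : 0 < c) (hl : 1 ≤ l) (hD : ∀ x, c • φ ≤ kernelIter κ l x)
    (hf : Measurable f) {M : ℝ} (hM : ∀ x, |f x| ≤ M) (n : ℕ) (x y : α) :
    kernelSum κ f n x - kernelSum κ f n y ≤ 2 * l * M / c := by
  have hfb : BddMeasurable f := ⟨hf, M, hM⟩
  have hM0 : 0 ≤ M := (abs_nonneg _).trans (hM x)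
  have hc0 : (0 : ℝ) < c := hc
  have hc1 : (c : ℝ) ≤ 1 := by
    have := hD x Set.univ
    rw [Measure.smul_apply, measure_univ, measure_univ, ENNReal.smul_def, smul_eq_mul, mul_one]
      at this
    exact_mod_cast this
  have hosc : ∀ (m : ℕ) (x y : α), kernelSum κ f m x - kernelSum κ f m y ≤ 2 * m * M := by
    intro m x y
    have h1 := abs_le.1 (abs_kernelSum_le (κ := κ) hM m x)
    have h2 := abs_le.1 (abs_kernelSum_le (κ := κ) hM m y)
    linarith
  induction n using Nat.strong_induction_on generalizing x y with
  | _ n ih =>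
    rcases lt_or_ge n l with hn | hn
    · refine (hosc n x y).trans ?_
      rw [le_div_iff₀ hc0]
      calc 2 * n * M * c ≤ 2 * n * M * 1 := by gcongr
        _ ≤ 2 * l * M := by rw [mul_one]; gcongr
    · obtain ⟨m, rfl⟩ := Nat.exists_eq_add_of_le hn
      have hb := hfb.kernelSum (κ := κ) m
      rw [kernelSum_add hfb, Pi.add_apply, Pi.add_apply, kernelAct_iterate hb,
        kernelAct_iterate hb]
      obtain ⟨hb, C, hC⟩ := hb
      have h1 := integral_sub_integral_le_of_smul_le _ _ φ (hD x) (hD y) hb hC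
        (ih m (by omega))
      have h2 := hosc l x y
      have h3 : (1 - (c : ℝ)) * (2 * l * M / c) = 2 * l * M / c - 2 * l * M := by
        field_simp
      linarith

end KernelAction

section MarkovChain

variable {Ω α β : Type*} [MeasurableSpace Ω] [MeasurableSpace α] [MeasurableSpace β]
  {P : Measure Ω} [IsProbabilityMeasure P]

/-- A random variable whose regular conditional law given `Y` is `η` and the law of `Y`
determine the joint law. -/
lemma map_prodMk_eq_compProd_of_condExp_indicator (η : Kernel α β) [IsMarkovKernel η]
    {Y : Ω → α} {V : Ω → β} (hY : Measurable Y) (hV : Measurable V)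
    (h : ∀ A : Set β, MeasurableSet A →
      (P[fun ω => A.indicator (fun _ => (1 : ℝ)) (V ω) |
          MeasurableSpace.comap Y inferInstance]) =ᵐ[P] fun ω => (η (Y ω) A).toReal) :
    P.map (fun ω => (Y ω, V ω)) = P.map Y ⊗ₘ η := by
  have hfin : IsProbabilityMeasure (P.map Y) := Measure.isProbabilityMeasure_map hY.aemeasurable
  have hfin' : IsProbabilityMeasure (P.map fun ω => (Y ω, V ω)) :=
    Measure.isProbabilityMeasure_map (hY.prodMk hV).aemeasurable
  refine Measure.ext_prod fun {s A} hs hA => ?_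
  have hint : Integrable (fun ω => A.indicator (fun _ => (1 : ℝ)) (V ω)) P := by
    refine integrable_of_measurable_of_abs_le P
      ((measurable_const.indicator hA).comp hV) (C := 1) fun ω => ?_
    by_cases hω : V ω ∈ A <;> simp [hω]
  have key := setIntegral_condExp hY.comap_le hint (s := Y ⁻¹' s) ⟨s, hs, rfl⟩
  rw [setIntegral_congr_ae (hY hs) ((h A hA).mono fun ω hω _ => hω)] at key
  rw [Measure.map_apply (hY.prodMk hV) (hs.prod hA), Measure.compProd_apply_prod hs hA,
    setLIntegral_map hs (Kernel.measurable_coe η hA) hY]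
  have e1 : ∫⁻ ω in Y ⁻¹' s, η (Y ω) A ∂P
      = ENNReal.ofReal (∫ ω in Y ⁻¹' s, (η (Y ω) A).toReal ∂P) := by
    have hmeas : Measurable fun ω => η (Y ω) A := (Kernel.measurable_coe η hA).comp hY
    rw [integral_toReal hmeas.aemeasurable (ae_of_all _ fun ω => measure_lt_top _ _),
      ENNReal.ofReal_toReal]
    refine ((lintegral_mono fun ω => prob_le_one).trans_lt ?_).ne
    simp
  have e2 : ∫ ω in Y ⁻¹' s, A.indicator (fun _ => (1 : ℝ)) (V ω) ∂P
      = P.real (V ⁻¹' A ∩ Y ⁻¹' s) := by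
    rw [← measureReal_restrict_apply (hV hA), ← integral_indicator_one (hV hA)]
    rfl
  rw [e1, key, e2, ofReal_measureReal, Set.inter_comm]
  rfl

/-- If `D (a, ·)` is sub-Gaussian under the conditional law of `V` given `Y = a`, uniformly in
`a`, then adding `D (Y, V)` to a sub-Gaussian function of `Y` adds the parameters. -/
lemma hasSubgaussianMGF_add_of_map_eq_compProd (η : Kernel α β) [IsMarkovKernel η]
    {Y : Ω → α} {V : Ω → β} (hY : Measurable Y) (hV : Measurable V)
    (h : P.map (fun ω => (Y ω, V ω)) = P.map Y ⊗ₘ η)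
    {Z : α → ℝ} (hZ : Measurable Z) {D : α × β → ℝ} (hD : Measurable D)
    {C : ℝ} (hC : ∀ p, |D p| ≤ C) {c d : ℝ≥0}
    (hZs : HasSubgaussianMGF (fun ω => Z (Y ω)) c P)
    (hDs : ∀ a, HasSubgaussianMGF (fun b => D (a, b)) d (η a)) :
    HasSubgaussianMGF (fun ω => Z (Y ω) + D (Y ω, V ω)) (c + d) P := by
  have hfin : IsProbabilityMeasure (P.map Y) := Measure.isProbabilityMeasure_map hY.aemeasurable
  have hint : ∀ t : ℝ, Integrable (fun ω => Real.exp (t * (Z (Y ω) + D (Y ω, V ω)))) P := by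
    intro t
    simp_rw [mul_add, Real.exp_add]
    refine (hZs.integrable_exp_mul t).mul_bdd (c := Real.exp (|t| * C))
      (Real.measurable_exp.comp ((hD.comp (hY.prodMk hV)).const_mul t)).aestronglyMeasurable
      (ae_of_all _ fun ω => ?_)
    rw [Real.norm_of_nonneg (Real.exp_nonneg _), Real.exp_le_exp]
    calc t * D (Y ω, V ω) ≤ |t * D (Y ω, V ω)| := le_abs_self _
      _ = |t| * |D (Y ω, V ω)| := abs_mul _ _
      _ ≤ |t| * C := by gcongr; exact hC _
  refine ⟨hint, fun t => ?_⟩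
  have hm : Measurable fun p : α × β => Real.exp (t * (Z p.1 + D p)) := by fun_prop
  have hYV := hY.prodMk hV
  have hint' : Integrable (fun p : α × β => Real.exp (t * (Z p.1 + D p))) (P.map Y ⊗ₘ η) := by
    rw [← h, integrable_map_measure hm.aestronglyMeasurable hYV.aemeasurable]
    exact hint t
  have hZi : Integrable (fun a => Real.exp (t * Z a)) (P.map Y) := by
    rw [integrable_map_measure (by fun_prop) hY.aemeasurable]
    exact hZs.integrable_exp_mul t
  calc mgf (fun ω => Z (Y ω) + D (Y ω, V ω)) P t
      = ∫ p, Real.exp (t * (Z p.1 + D p)) ∂(P.map fun ω => (Y ω, V ω)) := by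
        rw [integral_map hYV.aemeasurable hm.aestronglyMeasurable]; rfl
    _ = ∫ a, Real.exp (t * Z a) * ∫ b, Real.exp (t * D (a, b)) ∂η a ∂(P.map Y) := by
        rw [h, Measure.integral_compProd hint']
        simp_rw [mul_add, Real.exp_add, integral_const_mul]
    _ ≤ ∫ a, Real.exp (t * Z a) * Real.exp (d * t ^ 2 / 2) ∂(P.map Y) := by
        refine integral_mono_of_nonneg (ae_of_all _ fun a => ?_) (hZi.mul_const _)
          (ae_of_all _ fun a => ?_)
        · exact mul_nonneg (Real.exp_nonneg _) (integral_nonneg fun _ => Real.exp_nonneg _)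
        · exact mul_le_mul_of_nonneg_left ((hDs a).mgf_le t) (Real.exp_nonneg _)
    _ = mgf (fun ω => Z (Y ω)) P t * Real.exp (d * t ^ 2 / 2) := by
        rw [integral_mul_const, integral_map hY.aemeasurable (by fun_prop)]; rfl
    _ ≤ Real.exp (c * t ^ 2 / 2) * Real.exp (d * t ^ 2 / 2) := by
        gcongr; exact hZs.mgf_le t
    _ = Real.exp ((c + d : ℝ≥0) * t ^ 2 / 2) := by
        rw [← Real.exp_add]; push_cast; ring_nf

variable {κ : Kernel α α} [IsMarkovKernel κ] {X : ℕ → Ω → α}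

/-- The joint law of the past and the next state of a Markov chain. -/
lemma map_past_prodMk_eq_compProd (hX : ∀ t, Measurable (X t))
    (hMarkov : ∀ n : ℕ, ∀ A : Set α, MeasurableSet A →
      (P[fun ω => A.indicator (fun _ => (1 : ℝ)) (X (n + 1) ω) |
          MeasurableSpace.comap (fun ω (i : Fin (n + 1)) => X i ω) MeasurableSpace.pi])
        =ᵐ[P] fun ω => ((κ (X n ω)) A).toReal) (n : ℕ) :
    P.map (fun ω => ((fun i : Fin (n + 1) => X i ω), X (n + 1) ω))
      = P.map (fun ω (i : Fin (n + 1)) => X i ω) ⊗ₘ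
        κ.comap (fun u : Fin (n + 1) → α => u (Fin.last n)) (measurable_pi_apply _) := by
  refine map_prodMk_eq_compProd_of_condExp_indicator _
    (measurable_pi_lambda _ fun i => hX i) (hX _) fun A hA => ?_
  simpa [Kernel.comap_apply] using hMarkov n A hA

lemma integral_next_eq (hX : ∀ t, Measurable (X t))
    (hlaw : ∀ n : ℕ, P.map (fun ω => ((fun i : Fin (n + 1) => X i ω), X (n + 1) ω))
      = P.map (fun ω (i : Fin (n + 1)) => X i ω) ⊗ₘ
        κ.comap (fun u : Fin (n + 1) → α => u (Fin.last n)) (measurable_pi_apply _))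
    {g : α → ℝ} (hg : BddMeasurable g) (n : ℕ) :
    ∫ ω, g (X (n + 1) ω) ∂P = ∫ ω, kernelAct κ g (X n ω) ∂P := by
  have hY : Measurable fun ω (i : Fin (n + 1)) => X i ω := measurable_pi_lambda _ fun i => hX i
  have hfin : IsProbabilityMeasure (P.map fun ω (i : Fin (n + 1)) => X i ω) :=
    Measure.isProbabilityMeasure_map hY.aemeasurable
  have hm : Measurable fun p : (Fin (n + 1) → α) × α => g p.2 := hg.1.comp measurable_snd
  have h1 := integral_map (hY.prodMk (hX (n + 1))).aemeasurable
    (μ := P) hm.aestronglyMeasurable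
  rw [hlaw n, Measure.integral_compProd] at h1
  · rw [← h1]
    have h2 := integral_map (μ := P) hY.aemeasurable
      (f := fun u => kernelAct κ g (u (Fin.last n)))
      ((hg.kernelAct.1.comp (measurable_pi_apply _)).aestronglyMeasurable)
    simpa [kernelAct, Kernel.comap_apply] using h2
  · obtain ⟨_, C, hC⟩ := hg
    exact integrable_of_measurable_of_abs_le _ hm fun p => hC p.2

/-- Sums of one-step martingale increments of functions of bounded oscillation along a Markov
chain are sub-Gaussian. -/
lemma hasSubgaussianMGF_sum_increments (hX : ∀ t, Measurable (X t))
    (hlaw : ∀ n : ℕ, P.map (fun ω => ((fun i : Fin (n + 1) => X i ω), X (n + 1) ω))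
      = P.map (fun ω (i : Fin (n + 1)) => X i ω) ⊗ₘ
        κ.comap (fun u : Fin (n + 1) → α => u (Fin.last n)) (measurable_pi_apply _))
    {G : ℕ → α → ℝ} (hG : ∀ k, BddMeasurable (G k)) {R : ℝ≥0}
    (hR : ∀ k x y, G k x - G k y ≤ R) (n : ℕ) :
    HasSubgaussianMGF
      (fun ω => ∑ k ∈ Finset.range n, (G k (X (k + 1) ω) - kernelAct κ (G k) (X k ω)))
      (n * (R / 2) ^ 2) P := by
  induction n with
  | zero => simp
  | succ n ih =>
    have hY : Measurable fun ω (i : Fin (n + 1)) => X i ω := measurable_pi_lambda _ fun i => hX i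
    simp_rw [Finset.sum_range_succ]
    obtain ⟨C, hC⟩ := (hG n).2
    have hK := (hG n).kernelAct (κ := κ)
    have hb : ∀ x, |kernelAct κ (G n) x| ≤ C := fun x => abs_integral_le_of_abs_le _ hC
    have key := hasSubgaussianMGF_add_of_map_eq_compProd
      (κ.comap (fun u : Fin (n + 1) → α => u (Fin.last n)) (measurable_pi_apply _))
      hY (hX (n + 1)) (hlaw n) (c := n * (R / 2) ^ 2) (d := (R / 2) ^ 2) (C := C + C)
      (Z := fun u => ∑ k : Fin n, (G k (u k.succ) - kernelAct κ (G k) (u k.castSucc)))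
      (D := fun p => G n p.2 - kernelAct κ (G n) (p.1 (Fin.last n)))
      (Finset.measurable_sum _ fun k _ => ((hG k).1.comp (measurable_pi_apply _)).sub
        ((hG k).kernelAct.1.comp (measurable_pi_apply _)))
      (((hG n).1.comp measurable_snd).sub
        (hK.1.comp ((measurable_pi_apply _).comp measurable_fst)))
      (fun p => (abs_sub _ _).trans (add_le_add (hC _) (hb _)))
      (by simpa [Finset.sum_range] using ih) ?_
    · convert! key using 1
      · ext ω
        simp [Finset.sum_range]
      · push_cast; ring
    · intro u
      rw [Kernel.comap_apply]
      have : Nonempty α := ⟨u 0⟩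
      have hbdd : BddBelow (Set.range (G n)) := ⟨-C, by
        rintro _ ⟨x, rfl⟩; exact (abs_le.1 (hC x)).1⟩
      have hIcc : ∀ y, G n y ∈ Set.Icc (⨅ x, G n x) ((⨅ x, G n x) + R) := fun y =>
        ⟨ciInf_le hbdd y, by
          have : G n y - R ≤ ⨅ x, G n x := le_ciInf fun z => by linarith [hR n y z]
          linarith⟩
      have := hasSubgaussianMGF_of_mem_Icc (μ := κ (u (Fin.last n)))
        (hG n).1.aemeasurable (ae_of_all _ hIcc)
      simpa [kernelAct] using this

/-- Decomposition of the partial sums of a function along a path into increments. -/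
lemma sum_eq_sum_increments_add (κ : Kernel α α) (f : α → ℝ) (x : ℕ → α) (n : ℕ) :
    ∑ t ∈ Finset.Icc 1 n, f (x t)
      = ∑ k ∈ Finset.range n, (kernelSum κ f (n - k) (x (k + 1))
          - kernelAct κ (kernelSum κ f (n - k)) (x k))
        + kernelAct κ (kernelSum κ f n) (x 0) := by
  have key : ∀ m ≤ n, ∑ t ∈ Finset.Icc 1 m, f (x t)
      + kernelAct κ (kernelSum κ f (n - m)) (x m)
      = ∑ k ∈ Finset.range m, (kernelSum κ f (n - k) (x (k + 1))
          - kernelAct κ (kernelSum κ f (n - k)) (x k))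
        + kernelAct κ (kernelSum κ f n) (x 0) := by
    intro m hm
    induction m with
    | zero => simp
    | succ m ih =>
      have h := ih (by omega)
      have e : n - m = (n - (m + 1)) + 1 := by omega
      have h2 : kernelSum κ f (n - m) (x (m + 1))
          = f (x (m + 1)) + kernelAct κ (kernelSum κ f (n - (m + 1))) (x (m + 1)) := by
        rw [e, kernelSum]; rfl
      rw [Finset.sum_Icc_succ_top (by omega), Finset.sum_range_succ, h2]
      linarith
  have h := key n le_rfl
  rw [← h]
  simp [kernelSum, kernelAct]

lemma HasSubgaussianMGF.measure_abs_ge_le {Z : Ω → ℝ} {c : ℝ≥0} (hZ : HasSubgaussianMGF Z c P)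
    {ε : ℝ} (hε : 0 ≤ ε) :
    P.real {ω | ε ≤ |Z ω|} ≤ 2 * Real.exp (-ε ^ 2 / (2 * c)) := by
  have hsub : {ω | ε ≤ |Z ω|} ⊆ {ω | ε ≤ Z ω} ∪ {ω | ε ≤ (-Z) ω} := fun ω hω => by
    simpa [le_abs] using hω
  calc P.real {ω | ε ≤ |Z ω|} ≤ P.real {ω | ε ≤ Z ω} + P.real {ω | ε ≤ (-Z) ω} :=
        (measureReal_mono hsub).trans (measureReal_union_le _ _)
    _ ≤ 2 * Real.exp (-ε ^ 2 / (2 * c)) := by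
        linarith [hZ.measure_ge_le hε, hZ.neg.measure_ge_le hε]

end MarkovChain

/-- Hoeffding's inequality for uniformly ergodic Markov chains (Glynn–Ormoneit).
Let `κ` be a Markov kernel on a standard Borel space satisfying Doeblin's condition with
constants `(l, lam)` and minorizing probability measure `φ`, and let `{X_t}` be a Markov
chain with transition kernel `κ` (started from an arbitrary initial distribution, the
Markov property being expressed through conditional expectations given the past).
For a bounded measurable `f` with `‖f‖ = sup_x |f x|`, set `S_n = Σ_{t=1}^n f(X_t)` and
`μ_f = 2(l+1)‖f‖/lam`. Then for every `ε > 0` and every `n > μ_f/ε`,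
`ℙ(|S_n − 𝔼[S_n]| ≥ nε) ≤ 2 exp(−2(nε − μ_f)²/(n μ_f²))`. -/
theorem hoeffding_uniformly_ergodic {𝓧 : Type*} [MeasurableSpace 𝓧]
    [StandardBorelSpace 𝓧] [Nonempty 𝓧]
    (κ : Kernel 𝓧 𝓧) [IsMarkovKernel κ]
    (φ : Measure 𝓧) [IsProbabilityMeasure φ] (lam : ℝ≥0) (l : ℕ)
    (hlam : 0 < lam) (hl : 1 ≤ l)
    (hDoeblin : ∀ x : 𝓧, ∀ A : Set 𝓧, MeasurableSet A →
      (lam : ℝ≥0∞) * φ A ≤ kernelIter κ l x A)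
    {Ω : Type*} [MeasurableSpace Ω] (P : Measure Ω) [IsProbabilityMeasure P]
    (X : ℕ → Ω → 𝓧) (hX : ∀ t, Measurable (X t))
    (hMarkov : ∀ n : ℕ, ∀ A : Set 𝓧, MeasurableSet A →
      (P[fun ω => A.indicator (fun _ => (1 : ℝ)) (X (n + 1) ω) |
          MeasurableSpace.comap (fun ω (i : Fin (n + 1)) => X i ω) MeasurableSpace.pi])
        =ᵐ[P] fun ω => ((κ (X n ω)) A).toReal)
    (f : 𝓧 → ℝ) (hf : Measurable f) (hf_bdd : BddAbove (Set.range fun x => |f x|)) :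
    ∀ ε : ℝ, 0 < ε → ∀ n : ℕ,
      (2 * (l + 1) * (⨆ x, |f x|) / lam) / ε < n →
      P {ω | (n : ℝ) * ε ≤
          |(∑ t ∈ Finset.Icc 1 n, f (X t ω)) -
            ∫ ω', (∑ t ∈ Finset.Icc 1 n, f (X t ω')) ∂P|} ≤
        ENNReal.ofReal (2 * Real.exp
          (-2 * ((n : ℝ) * ε - 2 * (l + 1) * (⨆ x, |f x|) / lam) ^ 2 /
            ((n : ℝ) * (2 * (l + 1) * (⨆ x, |f x|) / lam) ^ 2))) := by
  intro ε hε n hn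
  set M : ℝ := ⨆ x, |f x|
  have hM : ∀ x, |f x| ≤ M := fun x => le_ciSup hf_bdd x
  have hM0 : 0 ≤ M := Real.iSup_nonneg fun x => abs_nonneg _
  have hlam0 : (0 : ℝ) < lam := hlam
  obtain ⟨B, hB⟩ : ∃ B : ℝ≥0, (B : ℝ) = 2 * (l + 1) * M / lam := ⟨⟨_, by positivity⟩, rfl⟩
  rw [← hB] at hn ⊢
  have hfb : BddMeasurable f := ⟨hf, M, hM⟩
  have hD : ∀ x, lam • φ ≤ kernelIter κ l x := fun x =>
    Measure.le_iff.2 fun A hA => hDoeblin x A hA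
  have hosc : ∀ m x y, kernelSum κ f m x - kernelSum κ f m y ≤ B := fun m x y => by
    refine (kernelSum_sub_le φ hlam hl hD hf hM m x y).trans ?_
    rw [hB]
    gcongr
    linarith
  have hlaw := map_past_prodMk_eq_compProd hX hMarkov
  have hG := fun m => hfb.kernelSum (κ := κ) m
  set Z : Ω → ℝ := fun ω => ∑ k ∈ Finset.range n, (kernelSum κ f (n - k) (X (k + 1) ω)
    - kernelAct κ (kernelSum κ f (n - k)) (X k ω)) with hZdef
  have hZs : HasSubgaussianMGF Z (n * (B / 2) ^ 2) P :=
    hasSubgaussianMGF_sum_increments hX hlaw (fun k => hG (n - k)) (fun k => hosc (n - k)) n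
  have hcomp : ∀ {g : 𝓧 → ℝ}, BddMeasurable g → ∀ t, Integrable (fun ω => g (X t ω)) P :=
    fun {g} hg t => by
      obtain ⟨hm, C, hC⟩ := hg
      exact integrable_of_measurable_of_abs_le P (hm.comp (hX t)) fun ω => hC _
  have hZi : ∀ k ∈ Finset.range n, Integrable (fun ω => kernelSum κ f (n - k) (X (k + 1) ω)
      - kernelAct κ (kernelSum κ f (n - k)) (X k ω)) P := fun k _ =>
    (hcomp (hG _) _).sub (hcomp (hG _).kernelAct _)
  have hZ0 : ∫ ω, Z ω ∂P = 0 := by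
    rw [integral_finsetSum _ hZi]
    refine Finset.sum_eq_zero fun k _ => ?_
    rw [integral_sub (hcomp (hG _) _) (hcomp (hG _).kernelAct _),
      integral_next_eq hX hlaw (hG _), sub_self]
  set K := kernelAct κ (kernelSum κ f n)
  have hKb : BddMeasurable K := (hG n).kernelAct
  have hKosc : ∀ x y, K x - K y ≤ B := fun x y => by
    obtain ⟨hm, C, hC⟩ := hG n
    exact integral_sub_integral_le _ _ hm hC (hosc n)
  have hS : ∀ ω, ∑ t ∈ Finset.Icc 1 n, f (X t ω) = Z ω + K (X 0 ω) := fun ω =>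
    sum_eq_sum_increments_add κ f (fun t => X t ω) n
  have hES : ∫ ω, (∑ t ∈ Finset.Icc 1 n, f (X t ω)) ∂P = ∫ ω, K (X 0 ω) ∂P := by
    simp_rw [hS]
    rw [integral_add (integrable_finsetSum _ hZi) (hcomp hKb 0), hZ0, zero_add]
  have hdev : ∀ ω, |K (X 0 ω) - ∫ ω', K (X 0 ω') ∂P| ≤ B := fun ω => by
    have h1 : ∫ ω', (K (X 0 ω) - B) ∂P ≤ ∫ ω', K (X 0 ω') ∂P :=
      integral_mono (integrable_const _) (hcomp hKb 0) fun ω' => by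
        linarith [hKosc (X 0 ω) (X 0 ω')]
    have h2 : ∫ ω', K (X 0 ω') ∂P ≤ ∫ ω', (K (X 0 ω) + B) ∂P :=
      integral_mono (hcomp hKb 0) (integrable_const _) fun ω' => by
        linarith [hKosc (X 0 ω') (X 0 ω)]
    simp only [integral_const, probReal_univ, one_smul] at h1 h2
    rw [abs_le]
    constructor <;> linarith
  have hpos : 0 ≤ n * ε - B := by
    rw [div_lt_iff₀ hε] at hn
    linarith
  rw [hES]
  refine (measure_mono (t := {ω | n * ε - B ≤ |Z ω|}) fun ω hω => ?_).trans ?_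
  · simp only [Set.mem_ofPred_eq, hS] at hω ⊢
    have := abs_add_le (Z ω) (K (X 0 ω) - ∫ ω', K (X 0 ω') ∂P)
    rw [← add_sub_assoc] at this
    linarith [hdev ω]
  · rw [← ofReal_measureReal]
    refine ENNReal.ofReal_le_ofReal ((HasSubgaussianMGF.measure_abs_ge_le hZs hpos).trans_eq ?_)
    congr 2
    push_cast
    rcases eq_or_ne ((n : ℝ) * B ^ 2) 0 with h0 | h0
    · have : 2 * ((n : ℝ) * ((B : ℝ) / 2) ^ 2) = 0 := by linear_combination h0 / 2
      rw [h0, this, div_zero, div_zero]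
    · have hn0 := left_ne_zero_of_mul h0
      have hB0 : (B : ℝ) ≠ 0 := fun h => by simp [h] at h0
      field_simp
end

section
/- Let {Y_i}_{i≥1} be a sequence of real random variables on a probability space, and let constants μ > 0, δ > 0, and a threshold b > μ be given. Suppose the Hoeffding-type bound ℙ(Σ_{i=k}^n Y_i ≥ b) ≤ exp(−2(b − μ + (n−k+1)δ)² / ((n−k+1)·μ²)) holds for all integers 1 ≤ k ≤ n. Define the CUSUM stopping time T(b) = inf{ n ≥ 1 : max_{1≤k≤n} Σ_{i=k}^n Y_i ≥ b }. Then the mean time to false alarm satisfies 𝔼[T(b)] ≥ (2√2/3)·exp(4δ(b − μ)/μ²). -/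
open MeasureTheory
open scoped ENNReal

/-- The CUSUM stopping time with increments `Y` and threshold `b`:
`T(b) = inf{ n ≥ 1 : max_{1 ≤ k ≤ n} Σ_{i=k}^n Y_i ≥ b }` (`∞` if no such `n`). -/
noncomputable def cusumTime {Ω : Type*} (Y : ℕ → Ω → ℝ) (b : ℝ) (ω : Ω) : ℝ≥0∞ :=
  sInf {t : ℝ≥0∞ | ∃ n : ℕ, 1 ≤ n ∧ t = n ∧
    ∃ k, 1 ≤ k ∧ k ≤ n ∧ b ≤ ∑ i ∈ Finset.Icc k n, Y i ω}

/-- The event that some partial sum `Σ_{i=k}^m Y_i` with `1 ≤ k ≤ m ≤ n` reaches `b`,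
i.e. that the CUSUM procedure has stopped by time `n`. -/
def cusumStoppedBy {Ω : Type*} (Y : ℕ → Ω → ℝ) (b : ℝ) (n : ℕ) : Set Ω :=
  ⋃ m ∈ Finset.Icc 1 n, ⋃ k ∈ Finset.Icc 1 m, {ω | b ≤ ∑ i ∈ Finset.Icc k m, Y i ω}

theorem measurableSet_cusumStoppedBy {Ω : Type*} [MeasurableSpace Ω] {Y : ℕ → Ω → ℝ}
    (hY : ∀ i, Measurable (Y i)) (b : ℝ) (n : ℕ) : MeasurableSet (cusumStoppedBy Y b n) :=
  Finset.measurableSet_biUnion _ fun _ _ => Finset.measurableSet_biUnion _ fun _ _ =>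
    measurableSet_le measurable_const (Finset.measurable_sum _ fun i _ => hY i)

/-- A truncated tail-sum lower bound for the stopping time. -/
theorem sum_indicator_compl_cusumStoppedBy_le {Ω : Type*} (Y : ℕ → Ω → ℝ) (b : ℝ) (M : ℕ)
    (ω : Ω) :
    ∑ n ∈ Finset.range M, (cusumStoppedBy Y b n)ᶜ.indicator (fun _ => (1 : ℝ≥0∞)) ω ≤
      cusumTime Y b ω := by
  refine le_sInf ?_
  rintro t ⟨m, hm, rfl, k, hk, hkm, hsum⟩
  calc ∑ n ∈ Finset.range M, (cusumStoppedBy Y b n)ᶜ.indicator (fun _ => (1 : ℝ≥0∞)) ω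
      ≤ ∑ n ∈ Finset.range M, if n < m then 1 else 0 := by
        refine Finset.sum_le_sum fun n _ => ?_
        split_ifs with h
        · exact Set.indicator_le_self' (fun _ _ => zero_le) ω
        · have hω : ω ∈ cusumStoppedBy Y b n := by
            simp only [cusumStoppedBy, Set.mem_iUnion, Finset.mem_Icc, Set.mem_ofPred_eq]
            exact ⟨m, ⟨hm, not_lt.mp h⟩, k, ⟨hk, hkm⟩, hsum⟩
          simp [hω]
    _ ≤ (m : ℝ≥0∞) := by
        rw [Finset.sum_boole]
        have h : (Finset.range M).filter (· < m) ⊆ Finset.range m := fun n hn => by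
          simp_all
        simpa using Finset.card_le_card h

/-- Union bound over all pairs `1 ≤ k ≤ m ≤ n`. -/
theorem measureReal_cusumStoppedBy_le {Ω : Type*} [MeasurableSpace Ω] (P : Measure Ω)
    {Y : ℕ → Ω → ℝ} {b p : ℝ}
    (h : ∀ k m : ℕ, 1 ≤ k → k ≤ m → P.real {ω | b ≤ ∑ i ∈ Finset.Icc k m, Y i ω} ≤ p)
    (n : ℕ) : P.real (cusumStoppedBy Y b n) ≤ n * (n + 1) / 2 * p := by
  calc P.real (cusumStoppedBy Y b n)
      ≤ ∑ m ∈ Finset.Icc 1 n, ∑ k ∈ Finset.Icc 1 m,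
          P.real {ω | b ≤ ∑ i ∈ Finset.Icc k m, Y i ω} :=
        (measureReal_biUnion_finset_le _ _).trans
          (Finset.sum_le_sum fun _ _ => measureReal_biUnion_finset_le _ _)
    _ ≤ ∑ m ∈ Finset.Icc 1 n, ∑ k ∈ Finset.Icc 1 m, p := by
        refine Finset.sum_le_sum fun m _ => Finset.sum_le_sum fun k hk => ?_
        rw [Finset.mem_Icc] at hk
        exact h k m hk.1 hk.2
    _ = n * (n + 1) / 2 * p := by
        induction n with
        | zero => simp
        | succ n ih =>
          rw [Finset.sum_Icc_succ_top (by omega), ih]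
          simp
          ring

theorem sum_range_one_sub_triangular (p : ℝ) (M : ℕ) :
    ∑ n ∈ Finset.range M, (1 - (n * (n + 1) / 2 * p : ℝ)) = M - p * (M ^ 3 - M) / 6 := by
  induction M with
  | zero => simp
  | succ M ih =>
    rw [Finset.sum_range_succ, ih]
    push_cast
    ring

/-- The maximum over natural numbers of the cubic `M - (M³ - M) / (3 x²)` is at least the
maximum `2 x / 3` over the reals of `M - M³ / (3 x²)`. -/
theorem exists_nat_two_thirds_mul_le {x : ℝ} (hx : 1 ≤ x) :
    ∃ M : ℕ, 2 / 3 * x ≤ M - 2 / x ^ 2 * ((M : ℝ) ^ 3 - M) / 6 := by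
  obtain ⟨M, hM⟩ : ∃ M : ℕ, M = ⌊x + 1 / 2⌋₊ := ⟨_, rfl⟩
  have h1 : (M : ℝ) ≤ x + 1 / 2 := hM ▸ Nat.floor_le (by linarith)
  have h2 : x + 1 / 2 < M + 1 := hM ▸ Nat.lt_floor_add_one _
  have h3 : (1 : ℝ) ≤ M := by
    exact_mod_cast (hM ▸ Nat.le_floor (by push_cast; linarith) : 1 ≤ M)
  refine ⟨M, ?_⟩
  have hsq : (x - M) ^ 2 ≤ 1 / 4 := by nlinarith
  have hcub : (x - M) ^ 2 * (2 * x + M) ≤ M := by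
    nlinarith [mul_le_mul_of_nonneg_right hsq (by linarith : (0 : ℝ) ≤ 2 * x + M)]
  have hx2 : 0 < x ^ 2 := by positivity
  have key : M - 2 / x ^ 2 * ((M : ℝ) ^ 3 - M) / 6 - 2 / 3 * x =
      (M - (x - M) ^ 2 * (2 * x + M)) / (3 * x ^ 2) := by
    field_simp
    ring
  have : 0 ≤ (M - (x - M) ^ 2 * (2 * x + M)) / (3 * x ^ 2) :=
    div_nonneg (by linarith) (by positivity)
  linarith

/-- The Hoeffding exponent is bounded uniformly in the window length `m`. -/
theorem hoeffding_exponent_le {c δ μ m : ℝ} (hμ : 0 < μ) (hm : 0 < m) :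
    -2 * (c + m * δ) ^ 2 / (m * μ ^ 2) ≤ -(8 * δ * c / μ ^ 2) := by
  rw [← neg_div, div_le_div_iff₀ (by positivity) (by positivity)]
  nlinarith [mul_nonneg (sq_nonneg (c - m * δ)) (sq_nonneg μ)]

/-- Exponential lower bound on the mean time to false alarm: if the partial sums of the
increments satisfy the Hoeffding-type bound
`ℙ(Σ_{i=k}^n Y_i ≥ b) ≤ exp(−2(b − μ + (n−k+1)δ)²/((n−k+1)μ²))` for all `1 ≤ k ≤ n`,
then `𝔼[T(b)] ≥ (2√2/3)·exp(4δ(b − μ)/μ²)`. -/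
theorem cusum_false_alarm_lower_bound {Ω : Type*} [MeasurableSpace Ω]
    (ℙ : Measure Ω) [IsProbabilityMeasure ℙ]
    (Y : ℕ → Ω → ℝ) (hY : ∀ i, Measurable (Y i))
    (μ δ b : ℝ) (hμ : 0 < μ) (hδ : 0 < δ) (hb : μ < b)
    (hHoeffding : ∀ k n : ℕ, 1 ≤ k → k ≤ n →
      ℙ {ω | b ≤ ∑ i ∈ Finset.Icc k n, Y i ω} ≤
        ENNReal.ofReal (Real.exp (-2 * (b - μ + ((n : ℝ) - k + 1) * δ) ^ 2 /
          (((n : ℝ) - k + 1) * μ ^ 2)))) :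
    ENNReal.ofReal ((2 * Real.sqrt 2 / 3) * Real.exp (4 * δ * (b - μ) / μ ^ 2)) ≤
      ∫⁻ ω, cusumTime Y b ω ∂ℙ := by
  set E := Real.exp (4 * δ * (b - μ) / μ ^ 2) with hE
  have hE1 : 1 ≤ E :=
    Real.one_le_exp (div_nonneg (mul_nonneg (by positivity) (by linarith)) (by positivity))
  set x := Real.sqrt 2 * E with hx
  have hp : 2 / x ^ 2 = Real.exp (-(8 * δ * (b - μ) / μ ^ 2)) := by
    have hEE : Real.exp (8 * δ * (b - μ) / μ ^ 2) = E ^ 2 := by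
      rw [hE, ← Real.exp_nat_mul]
      congr 1
      push_cast
      ring
    rw [Real.exp_neg, hEE, hx, mul_pow, Real.sq_sqrt zero_le_two]
    field_simp
  have hbound : ∀ k m : ℕ, 1 ≤ k → k ≤ m →
      ℙ.real {ω | b ≤ ∑ i ∈ Finset.Icc k m, Y i ω} ≤ 2 / x ^ 2 := by
    intro k m hk hkm
    refine (ENNReal.toReal_le_of_le_ofReal (Real.exp_nonneg _) (hHoeffding k m hk hkm)).trans ?_
    have hkm' : (k : ℝ) ≤ m := by exact_mod_cast hkm
    rw [hp]
    exact Real.exp_le_exp.mpr (hoeffding_exponent_le hμ (by linarith))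
  have hx1 : 1 ≤ x := one_le_mul_of_one_le_of_one_le (Real.one_le_sqrt.mpr one_le_two) hE1
  obtain ⟨M, hM⟩ := exists_nat_two_thirds_mul_le hx1
  have hmeas := measurableSet_cusumStoppedBy hY b
  calc ENNReal.ofReal ((2 * Real.sqrt 2 / 3) * E)
      ≤ ENNReal.ofReal (∑ n ∈ Finset.range M, ℙ.real (cusumStoppedBy Y b n)ᶜ) := by
        refine ENNReal.ofReal_le_ofReal ?_
        calc (2 * Real.sqrt 2 / 3) * E = 2 / 3 * x := by rw [hx]; ring
          _ ≤ ∑ n ∈ Finset.range M, (1 - (n * (n + 1) / 2 * (2 / x ^ 2) : ℝ)) := by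
            rwa [sum_range_one_sub_triangular]
          _ ≤ _ := by
            refine Finset.sum_le_sum fun n _ => ?_
            rw [probReal_compl_eq_one_sub (hmeas n)]
            exact sub_le_sub_left (measureReal_cusumStoppedBy_le ℙ hbound n) 1
    _ = ∑ n ∈ Finset.range M, ℙ (cusumStoppedBy Y b n)ᶜ := by
        rw [ENNReal.ofReal_sum_of_nonneg fun _ _ => measureReal_nonneg]
        exact Finset.sum_congr rfl fun n _ => ofReal_measureReal
    _ = ∫⁻ ω, ∑ n ∈ Finset.range M,
          (cusumStoppedBy Y b n)ᶜ.indicator (fun _ => (1 : ℝ≥0∞)) ω ∂ℙ := by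
        rw [lintegral_finsetSum _ fun n _ => measurable_const.indicator (hmeas n).compl]
        refine Finset.sum_congr rfl fun n _ => ?_
        rw [lintegral_indicator_const (hmeas n).compl, one_mul]
    _ ≤ ∫⁻ ω, cusumTime Y b ω ∂ℙ :=
        lintegral_mono fun ω => sum_indicator_compl_cusumStoppedBy_le Y b M ω
end

section
/- Let T be a random variable taking values in {1, 2, 3, ...} ∪ {∞} and let 0 < q ≤ 1 be a constant such that ℙ(T ≤ N) ≤ q·N(N+1)/2 for every integer N ≥ 1. Then 𝔼[T] ≥ (2√2/3)·q^{−1/2}. -/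
open MeasureTheory
open scoped ENNReal

lemma sum_range_indicator_lt_le (L : ℕ) (t : ℕ∞) :
    ∑ N ∈ Finset.range L, (if (N : ℕ∞) < t then (1 : ℝ≥0∞) else 0) ≤ (t : ℝ≥0∞) := by
  induction t using ENat.recTopCoe with
  | top => simp
  | coe n =>
    simp only [Nat.cast_lt, Finset.sum_boole, ENat.toENNReal_coe, Nat.cast_le]
    calc _ ≤ (Finset.range n).card := Finset.card_le_card fun N hN => by
            simpa using (Finset.mem_filter.mp hN).2
      _ = n := Finset.card_range n

/-- Lower half of the tail-sum formula; `T` need not be measurable. -/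
lemma sum_one_sub_measure_le_lintegral {Ω : Type*} [MeasurableSpace Ω]
    (μ : Measure Ω) [IsProbabilityMeasure μ] (T : Ω → ℕ∞) (L : ℕ) :
    ∑ N ∈ Finset.range L, (1 - μ {ω | T ω ≤ (N : ℕ∞)}) ≤ ∫⁻ ω, (T ω : ℝ≥0∞) ∂μ := by
  set A : ℕ → Set Ω := fun N => toMeasurable μ {ω | T ω ≤ (N : ℕ∞)}
  have hA (N : ℕ) : MeasurableSet (A N) := measurableSet_toMeasurable _ _
  calc ∑ N ∈ Finset.range L, (1 - μ {ω | T ω ≤ (N : ℕ∞)})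
      = ∑ N ∈ Finset.range L, ∫⁻ ω, (A N)ᶜ.indicator 1 ω ∂μ := by
        refine Finset.sum_congr rfl fun N _ => ?_
        rw [lintegral_indicator_one (hA N).compl, prob_compl_eq_one_sub (hA N),
          measure_toMeasurable]
    _ = ∫⁻ ω, ∑ N ∈ Finset.range L, (A N)ᶜ.indicator 1 ω ∂μ :=
        (lintegral_finsetSum _ fun N _ => measurable_one.indicator (hA N).compl).symm
    _ ≤ ∫⁻ ω, (T ω : ℝ≥0∞) ∂μ := by
        refine lintegral_mono fun ω => le_trans (Finset.sum_le_sum fun N _ => ?_)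
          (sum_range_indicator_lt_le L (T ω))
        refine Set.indicator_apply_le' (fun h => ?_) fun _ => zero_le
        have hlt : (N : ℕ∞) < T ω :=
          not_le.mp fun hle => h (subset_toMeasurable μ {ω | T ω ≤ (N : ℕ∞)} hle)
        simp [hlt]

lemma sum_range_one_sub_mul_choose_two (q : ℝ) (L : ℕ) :
    ∑ N ∈ Finset.range L, (1 - q * N * (N + 1) / 2) = L - q * ((L : ℝ) ^ 3 - L) / 6 := by
  induction L with
  | zero => simp
  | succ L ih =>
    rw [Finset.sum_range_succ, ih]
    push_cast
    ring

/-- The optimal truncation level is the integer nearest to `√(2 / q)`. -/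
lemma exists_two_sqrt_two_div_three_le (q : ℝ) (hq0 : 0 < q) (hq1 : q ≤ 1) :
    ∃ L : ℕ, (2 * Real.sqrt 2 / 3) * (Real.sqrt q)⁻¹ ≤ L - q * ((L : ℝ) ^ 3 - L) / 6 := by
  set s : ℝ := Real.sqrt 2 * (Real.sqrt q)⁻¹ with hs
  have hs0 : 0 < s := by positivity
  have hsq : q * s ^ 2 = 2 := by
    rw [hs, mul_pow, inv_pow, Real.sq_sqrt hq0.le, Real.sq_sqrt (by norm_num)]
    field_simp
  have hs1 : 1 ≤ s := by nlinarith
  refine ⟨⌊s + 1 / 2⌋₊, ?_⟩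
  have hle : (⌊s + 1 / 2⌋₊ : ℝ) ≤ s + 1 / 2 := Nat.floor_le (by positivity)
  have hlt : s + 1 / 2 < ⌊s + 1 / 2⌋₊ + 1 := Nat.lt_floor_add_one _
  have hL1 : (1 : ℝ) ≤ ⌊s + 1 / 2⌋₊ := by
    exact_mod_cast Nat.le_floor (by push_cast; linarith)
  generalize (⌊s + 1 / 2⌋₊ : ℝ) = L at *
  have hsquare : (s - L) ^ 2 ≤ 1 / 4 := by nlinarith
  have hcubic : (s - L) ^ 2 * (2 * s + L) ≤ L := by
    nlinarith [mul_le_mul_of_nonneg_right hsquare (by linarith : 0 ≤ 2 * s + L)]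
  have hcubic' : 0 ≤ q * (L - (s - L) ^ 2 * (2 * s + L)) :=
    mul_nonneg hq0.le (by linarith)
  have hlhs : (2 * Real.sqrt 2 / 3) * (Real.sqrt q)⁻¹ = 2 / 3 * s := by rw [hs]; ring
  rw [hlhs]
  linear_combination hcubic' / 6 + (L / 2 - s / 3) * hsq

/-- The counting argument behind the false-alarm lower bound: if `T` takes values in
`{1, 2, 3, ...} ∪ {∞}` and `ℙ(T ≤ N) ≤ q·N(N+1)/2` for every `N ≥ 1`, where
`0 < q ≤ 1`, then `𝔼[T] ≥ (2√2/3)·q^{−1/2}`. -/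
theorem stopping_time_counting_lower_bound {Ω : Type*} [MeasurableSpace Ω]
    (ℙ : Measure Ω) [IsProbabilityMeasure ℙ]
    (T : Ω → ℕ∞) (hT1 : ∀ ω, 1 ≤ T ω)
    (q : ℝ) (hq0 : 0 < q) (hq1 : q ≤ 1)
    (hbound : ∀ N : ℕ, 1 ≤ N →
      ℙ {ω | T ω ≤ (N : ℕ∞)} ≤ ENNReal.ofReal (q * N * (N + 1) / 2)) :
    ENNReal.ofReal ((2 * Real.sqrt 2 / 3) * (Real.sqrt q)⁻¹) ≤
      ∫⁻ ω, (T ω : ℝ≥0∞) ∂ℙ := by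
  obtain ⟨L, hL⟩ := exists_two_sqrt_two_div_three_le q hq0 hq1
  calc ENNReal.ofReal ((2 * Real.sqrt 2 / 3) * (Real.sqrt q)⁻¹)
      ≤ ENNReal.ofReal (∑ N ∈ Finset.range L, (1 - q * N * (N + 1) / 2)) :=
        ENNReal.ofReal_le_ofReal (hL.trans_eq (sum_range_one_sub_mul_choose_two q L).symm)
    _ ≤ ∑ N ∈ Finset.range L, ENNReal.ofReal (1 - q * N * (N + 1) / 2) :=
        Finset.le_sum_of_subadditive _ ENNReal.ofReal_zero.le
          (fun _ _ => ENNReal.ofReal_add_le) _ _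
    _ ≤ ∑ N ∈ Finset.range L, (1 - ℙ {ω | T ω ≤ (N : ℕ∞)}) := by
        refine Finset.sum_le_sum fun N _ => ?_
        rw [ENNReal.ofReal_sub _ (by positivity), ENNReal.ofReal_one]
        refine tsub_le_tsub_left ?_ 1
        rcases Nat.eq_zero_or_pos N with rfl | hN
        · have hempty : {ω | T ω ≤ ((0 : ℕ) : ℕ∞)} = ∅ :=
            Set.eq_empty_of_forall_notMem fun ω hω =>
              absurd ((hT1 ω).trans hω) (by simp)
          rw [hempty, measure_empty]
          exact zero_le
        · exact hbound N hN
    _ ≤ ∫⁻ ω, (T ω : ℝ≥0∞) ∂ℙ := sum_one_sub_measure_le_lintegral ℙ T L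
end

section
/- Let {Y_i}_{i≥1} be a sequence of real random variables on a probability space, let I > 0, μ > 0, and b > 0 be constants, set n₀ = ⌊(b + μ)/I⌋ and C = 2I²/μ². Suppose the one-sided Hoeffding-type bound ℙ(Σ_{k=1}^n Y_k < b) ≤ exp(−2(nI − b − μ)² / (n·μ²)) holds for every integer n ≥ n₀ + 1. Define the CUSUM stopping time T(b) = inf{ n ≥ 1 : max_{1≤k≤n} Σ_{i=k}^n Y_i ≥ b }. Then 𝔼[T(b)] ≤ 2 + n₀ + √(2π(n₀+1)/C) + (2/C)·exp(−C(n₀+1)/2). In particular 𝔼[T(b)] ≤ 1 + n₀(1 + o(1)) as n₀ → ∞. -/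
open MeasureTheory
open scoped ENNReal

/-- The CUSUM time is at most the number of `n` with `Σ_{k=1}^n Y_k < b`. -/
theorem cusumTime_le_tsum_indicator {Ω : Type*} (Y : ℕ → Ω → ℝ) {b : ℝ} (hb : 0 < b) (ω : Ω) :
    cusumTime Y b ω ≤
      ∑' n : ℕ, {ω | (∑ k ∈ Finset.Icc 1 n, Y k ω) < b}.indicator (1 : Ω → ℝ≥0∞) ω := by
  classical
  by_cases h : ∃ n : ℕ, b ≤ ∑ k ∈ Finset.Icc 1 n, Y k ω
  · have hpos : 1 ≤ Nat.find h := by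
      rw [Nat.one_le_iff_ne_zero]
      intro h0
      have hspec := Nat.find_spec h
      rw [h0] at hspec
      simp at hspec
      linarith
    calc cusumTime Y b ω ≤ (Nat.find h : ℝ≥0∞) :=
          sInf_le ⟨Nat.find h, hpos, rfl, 1, le_rfl, hpos, Nat.find_spec h⟩
      _ = ∑ n ∈ Finset.range (Nat.find h),
          {ω | (∑ k ∈ Finset.Icc 1 n, Y k ω) < b}.indicator (1 : Ω → ℝ≥0∞) ω := by
          rw [Finset.sum_congr rfl (g := fun _ => (1 : ℝ≥0∞))]
          · simp
          · intro n hn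
            have hlt : ω ∈ {ω | (∑ k ∈ Finset.Icc 1 n, Y k ω) < b} :=
              not_le.mp (Nat.find_min h (Finset.mem_range.mp hn))
            exact Set.indicator_of_mem hlt _
      _ ≤ _ := ENNReal.sum_le_tsum _
  · push Not at h
    have hone : ∀ n : ℕ,
        {ω | (∑ k ∈ Finset.Icc 1 n, Y k ω) < b}.indicator (1 : Ω → ℝ≥0∞) ω = 1 :=
      fun n => Set.indicator_of_mem (s := {ω | (∑ k ∈ Finset.Icc 1 n, Y k ω) < b}) (h n) _
    simp [hone]

/-- The expected CUSUM time is at most the sum of the lower-tail probabilities of the partial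
sums. -/
theorem lintegral_cusumTime_le_tsum {Ω : Type*} [MeasurableSpace Ω] (P : Measure Ω)
    {Y : ℕ → Ω → ℝ} (hY : ∀ i, Measurable (Y i)) {b : ℝ} (hb : 0 < b) :
    ∫⁻ ω, cusumTime Y b ω ∂P ≤ ∑' n : ℕ, P {ω | (∑ k ∈ Finset.Icc 1 n, Y k ω) < b} := by
  have hmeas : ∀ n : ℕ, MeasurableSet {ω | (∑ k ∈ Finset.Icc 1 n, Y k ω) < b} := fun n =>
    measurableSet_lt (Finset.measurable_sum _ fun i _ => hY i) measurable_const
  calc ∫⁻ ω, cusumTime Y b ω ∂P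
      ≤ ∫⁻ ω, ∑' n : ℕ,
          {ω | (∑ k ∈ Finset.Icc 1 n, Y k ω) < b}.indicator (1 : Ω → ℝ≥0∞) ω ∂P :=
        lintegral_mono fun ω => cusumTime_le_tsum_indicator Y hb ω
    _ = ∑' n : ℕ, P {ω | (∑ k ∈ Finset.Icc 1 n, Y k ω) < b} := by
        rw [lintegral_tsum fun n => (measurable_one.indicator (hmeas n)).aemeasurable]
        exact tsum_congr fun n => lintegral_indicator_one (hmeas n)

/-- A partial Gaussian sum is at most the half-line Gaussian integral. -/
theorem sum_exp_neg_mul_sq_le {a : ℝ} (ha : 0 < a) (m : ℕ) :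
    ∑ i ∈ Finset.range m, Real.exp (-a * ((i : ℝ) + 1) ^ 2) ≤ Real.sqrt (Real.pi / a) / 2 := by
  have hanti : AntitoneOn (fun x : ℝ => Real.exp (-a * x ^ 2)) (Set.Icc 0 (0 + (m : ℝ))) := by
    intro x hx y _ hxy
    have hsq : x ^ 2 ≤ y ^ 2 := pow_le_pow_left₀ hx.1 hxy 2
    exact Real.exp_le_exp.mpr (by nlinarith)
  have hsum := hanti.sum_le_integral
  simp only [zero_add, Nat.cast_add, Nat.cast_one] at hsum
  refine hsum.trans ?_
  rw [← integral_gaussian_Ioi a, intervalIntegral.integral_of_le (Nat.cast_nonneg m)]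
  exact setIntegral_mono_set (integrable_exp_neg_mul_sq ha).integrableOn
    (Filter.Eventually.of_forall fun x => (Real.exp_pos _).le)
    (Filter.Eventually.of_forall Set.Ioc_subset_Ioi_self)

/-- A tail of an exponential series is at most the integral of the exponential over that tail. -/
theorem tsum_ofReal_exp_neg_mul_le {c : ℝ} (hc : 0 < c) (m : ℕ) :
    ∑' i : ℕ, ENNReal.ofReal (Real.exp (-c * ((i : ℝ) + m + 1))) ≤
      ENNReal.ofReal (1 / c * Real.exp (-c * m)) := by
  have hr : Real.exp (-c) < 1 := Real.exp_lt_one_iff.mpr (by linarith)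
  have hfun : (fun i : ℕ => Real.exp (-c * ((i : ℝ) + m + 1))) =
      fun i : ℕ => Real.exp (-c * m) * Real.exp (-c) * Real.exp (-c) ^ i := by
    funext i
    rw [← Real.exp_nat_mul, ← Real.exp_add, ← Real.exp_add]
    ring_nf
  have hS : HasSum (fun i : ℕ => Real.exp (-c * ((i : ℝ) + m + 1)))
      (Real.exp (-c * m) * Real.exp (-c) * (1 - Real.exp (-c))⁻¹) := by
    rw [hfun]
    exact (hasSum_geometric_of_lt_one (Real.exp_pos _).le hr).mul_left _
  rw [← ENNReal.ofReal_tsum_of_nonneg (fun i => (Real.exp_pos _).le) hS.summable, hS.tsum_eq]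
  apply ENNReal.ofReal_le_ofReal
  have hratio : Real.exp (-c) * (1 - Real.exp (-c))⁻¹ ≤ 1 / c := by
    rw [← div_eq_mul_inv, div_le_div_iff₀ (by linarith) hc]
    have h1 : Real.exp (-c) * Real.exp c = 1 := by rw [← Real.exp_add]; simp
    nlinarith [Real.add_one_le_exp c, Real.exp_pos (-c)]
  calc _ = Real.exp (-c * m) * (Real.exp (-c) * (1 - Real.exp (-c))⁻¹) := by ring
    _ ≤ Real.exp (-c * m) * (1 / c) := by gcongr
    _ = _ := by ring

/-- The series `∑ exp(-C j² / (m + j))` is bounded by a Gaussian term, from the indices `j ≤ m`,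
plus an exponential term, from the indices `j > m`. -/
theorem tsum_ofReal_exp_neg_sq_div_le {C : ℝ} (hC : 0 < C) {m : ℕ} (hm : 0 < m) :
    ∑' j : ℕ, ENNReal.ofReal (Real.exp (-C * (j : ℝ) ^ 2 / ((m : ℝ) + j))) ≤
      ENNReal.ofReal (1 + Real.sqrt (2 * Real.pi * m / C) / 2 +
        2 / C * Real.exp (-C * m / 2)) := by
  have hm' : (0 : ℝ) < m := Nat.cast_pos.mpr hm
  have hhead : ∑ j ∈ Finset.range (m + 1), Real.exp (-C * (j : ℝ) ^ 2 / ((m : ℝ) + j)) ≤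
      1 + Real.sqrt (2 * Real.pi * m / C) / 2 := by
    have hgauss := sum_exp_neg_mul_sq_le (a := C / (2 * m)) (by positivity) m
    have hpi : Real.pi / (C / (2 * m)) = 2 * Real.pi * m / C := by field_simp
    rw [hpi] at hgauss
    rw [Finset.sum_range_succ', add_comm]
    refine add_le_add (by simp) (le_trans (Finset.sum_le_sum fun i hi => ?_) hgauss)
    have him : (i : ℝ) + 1 ≤ m := by exact_mod_cast Finset.mem_range.mp hi
    apply Real.exp_le_exp.mpr
    push_cast
    rw [neg_mul, neg_mul, neg_div, neg_le_neg_iff, div_mul_eq_mul_div]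
    exact div_le_div_of_nonneg_left (by positivity) (by positivity) (by linarith)
  have htail : ∑' i : ℕ, ENNReal.ofReal
      (Real.exp (-C * ((i + (m + 1) : ℕ) : ℝ) ^ 2 / ((m : ℝ) + (i + (m + 1) : ℕ)))) ≤
      ENNReal.ofReal (2 / C * Real.exp (-C * m / 2)) := by
    have hexp := tsum_ofReal_exp_neg_mul_le (c := C / 2) (by positivity) m
    have hrhs : 1 / (C / 2) * Real.exp (-(C / 2) * m) = 2 / C * Real.exp (-C * m / 2) := by
      rw [one_div_div]
      ring_nf
    rw [hrhs] at hexp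
    refine le_trans (ENNReal.tsum_le_tsum fun i => ?_) hexp
    apply ENNReal.ofReal_le_ofReal
    apply Real.exp_le_exp.mpr
    have hi : (0 : ℝ) ≤ i := Nat.cast_nonneg i
    push_cast
    rw [div_le_iff₀ (by positivity)]
    have : 0 ≤ C * (((i : ℝ) + m + 1) * (i + 1)) := by positivity
    nlinarith
  rw [← ENNReal.summable.sum_add_tsum_nat_add' (k := m + 1),
    ENNReal.ofReal_add (by positivity) (by positivity),
    ← ENNReal.ofReal_sum_of_nonneg fun j _ => (Real.exp_pos _).le]
  exact add_le_add (ENNReal.ofReal_le_ofReal hhead) htail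

/-- Detection-delay upper bound: with `n₀ = ⌊(b + μ)/I⌋` and `C = 2I²/μ²`, if
`ℙ(Σ_{k=1}^n Y_k < b) ≤ exp(−2(nI − b − μ)²/(nμ²))` for every `n ≥ n₀ + 1`, then
`𝔼[T(b)] ≤ 2 + n₀ + √(2π(n₀+1)/C) + (2/C)·exp(−C(n₀+1)/2)`
(so in particular `𝔼[T(b)] ≤ 1 + n₀(1 + o(1))` as `n₀ → ∞`). -/
theorem cusum_detection_delay_upper_bound {Ω : Type*} [MeasurableSpace Ω]
    (ℙ : Measure Ω) [IsProbabilityMeasure ℙ]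
    (Y : ℕ → Ω → ℝ) (hY : ∀ i, Measurable (Y i))
    (I μ b : ℝ) (hI : 0 < I) (hμ : 0 < μ) (hb : 0 < b)
    (n₀ : ℕ) (hn₀ : n₀ = Nat.floor ((b + μ) / I))
    (C : ℝ) (hC : C = 2 * I ^ 2 / μ ^ 2)
    (hHoeffding : ∀ n : ℕ, n₀ + 1 ≤ n →
      ℙ {ω | (∑ k ∈ Finset.Icc 1 n, Y k ω) < b} ≤
        ENNReal.ofReal (Real.exp (-2 * ((n : ℝ) * I - b - μ) ^ 2 / ((n : ℝ) * μ ^ 2)))) :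
    ∫⁻ ω, cusumTime Y b ω ∂ℙ ≤
      ENNReal.ofReal (2 + (n₀ : ℝ) + Real.sqrt (2 * Real.pi * ((n₀ : ℝ) + 1) / C) +
        (2 / C) * Real.exp (-C * ((n₀ : ℝ) + 1) / 2)) := by
  have hC0 : 0 < C := by rw [hC]; positivity
  have hfloor : b + μ < ((n₀ : ℝ) + 1) * I := by
    rw [← div_lt_iff₀ hI, hn₀]
    exact Nat.lt_floor_add_one _
  have hterm : ∀ j : ℕ, ℙ {ω | (∑ k ∈ Finset.Icc 1 (j + (n₀ + 1)), Y k ω) < b} ≤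
      ENNReal.ofReal (Real.exp (-C * (j : ℝ) ^ 2 / (((n₀ + 1 : ℕ) : ℝ) + j))) := by
    intro j
    refine (hHoeffding _ (Nat.le_add_left _ _)).trans (ENNReal.ofReal_le_ofReal ?_)
    apply Real.exp_le_exp.mpr
    have hj : (0 : ℝ) ≤ j := Nat.cast_nonneg j
    have hlow : (j : ℝ) * I ≤ ((j + (n₀ + 1) : ℕ) : ℝ) * I - b - μ := by
      push_cast
      nlinarith
    have hsq : ((j : ℝ) * I) ^ 2 ≤ (((j + (n₀ + 1) : ℕ) : ℝ) * I - b - μ) ^ 2 :=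
      pow_le_pow_left₀ (by positivity) hlow 2
    have hrhs : -C * (j : ℝ) ^ 2 / (((n₀ + 1 : ℕ) : ℝ) + j) =
        -2 * ((j : ℝ) * I) ^ 2 / (((j + (n₀ + 1) : ℕ) : ℝ) * μ ^ 2) := by
      rw [hC]
      push_cast
      have : (n₀ : ℝ) + 1 + j ≠ 0 := by positivity
      have : (j : ℝ) + (n₀ + 1) ≠ 0 := by positivity
      field_simp
      ring
    rw [hrhs]
    exact div_le_div_of_nonneg_right (by linarith) (by positivity)
  have hhead : ∑ n ∈ Finset.range (n₀ + 1), ℙ {ω | (∑ k ∈ Finset.Icc 1 n, Y k ω) < b} ≤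
      ENNReal.ofReal ((n₀ : ℝ) + 1) :=
    calc _ ≤ ∑ n ∈ Finset.range (n₀ + 1), (1 : ℝ≥0∞) := Finset.sum_le_sum fun _ _ => prob_le_one
      _ = ENNReal.ofReal ((n₀ : ℝ) + 1) := by
          rw [← Nat.cast_add_one, ENNReal.ofReal_natCast]
          simp
  refine (lintegral_cusumTime_le_tsum ℙ hY hb).trans ?_
  rw [← ENNReal.summable.sum_add_tsum_nat_add' (k := n₀ + 1)]
  refine (add_le_add hhead ((ENNReal.tsum_le_tsum hterm).trans
    (tsum_ofReal_exp_neg_sq_div_le hC0 n₀.succ_pos))).trans ?_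
  rw [← ENNReal.ofReal_add (by positivity) (by positivity)]
  apply ENNReal.ofReal_le_ofReal
  push_cast
  linarith [Real.sqrt_nonneg (2 * Real.pi * ((n₀ : ℝ) + 1) / C)]
end

section
/- For every real constant C > 0 and every natural number n₀, the series Σ_{k=1}^∞ exp(−C·k² / (k + n₀ + 1)) converges and satisfies Σ_{k=1}^∞ exp(−C·k² / (k + n₀ + 1)) ≤ √(2π(n₀+1)/C) + (2/C)·exp(−C(n₀+1)/2). -/
open Real

/-- A right-endpoint Riemann sum of a Gaussian is at most its integral over the half-line. -/
theorem sum_range_exp_neg_mul_sq_le {b : ℝ} (hb : 0 < b) (n : ℕ) :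
    ∑ i ∈ Finset.range n, Real.exp (-b * ((i : ℝ) + 1) ^ 2) ≤ √(π / b) / 2 := by
  have hanti : AntitoneOn (fun x : ℝ => Real.exp (-b * x ^ 2)) (Set.Icc 0 (0 + (n : ℝ))) := by
    intro x hx y _ hxy
    have h : x ^ 2 ≤ y ^ 2 := pow_le_pow_left₀ hx.1 hxy 2
    exact Real.exp_le_exp.2 (by nlinarith)
  calc ∑ i ∈ Finset.range n, Real.exp (-b * ((i : ℝ) + 1) ^ 2)
      ≤ ∫ x in (0 : ℝ)..0 + n, Real.exp (-b * x ^ 2) := by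
        simpa using hanti.sum_le_integral
    _ ≤ ∫ x in Set.Ioi (0 : ℝ), Real.exp (-b * x ^ 2) := by
        rw [intervalIntegral.integral_of_le (by simp)]
        exact MeasureTheory.setIntegral_mono_set (integrable_exp_neg_mul_sq hb).integrableOn
          (.of_forall fun x => (Real.exp_pos _).le) Set.Ioc_subset_Ioi_self.eventuallyLE
    _ = √(π / b) / 2 := integral_gaussian_Ioi b

theorem hasSum_exp_neg_mul_add_one {a : ℝ} (ha : 0 < a) (x : ℝ) :
    HasSum (fun i : ℕ => Real.exp (-a * (x + (i + 1)))) (Real.exp (-a * x) / (Real.exp a - 1)) := by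
  have hgeom := (hasSum_geometric_of_lt_one (Real.exp_pos (-a)).le
    (Real.exp_lt_one_iff.2 (neg_neg_of_pos ha))).mul_left (Real.exp (-a * x) * Real.exp (-a))
  have hterm (i : ℕ) : Real.exp (-a * (x + (i + 1))) =
      Real.exp (-a * x) * Real.exp (-a) * Real.exp (-a) ^ i := by
    rw [← Real.exp_nat_mul, ← Real.exp_add, ← Real.exp_add]
    ring_nf
  have hval : Real.exp (-a * x) / (Real.exp a - 1) =
      Real.exp (-a * x) * Real.exp (-a) * (1 - Real.exp (-a))⁻¹ := by
    have h1 : Real.exp a - 1 ≠ 0 := (sub_pos.2 (Real.one_lt_exp_iff.2 ha)).ne'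
    rw [Real.exp_neg a]
    have h2 := Real.exp_ne_zero a
    field_simp
  simpa only [hterm, hval] using hgeom

/-- Tail-sum estimate: for every `C > 0` and `n₀ ∈ ℕ`, the series
`Σ_{k=1}^∞ exp(−C·k²/(k + n₀ + 1))` converges and is bounded by
`√(2π(n₀+1)/C) + (2/C)·exp(−C(n₀+1)/2)`. -/
theorem tail_sum_estimate (C : ℝ) (hC : 0 < C) (n₀ : ℕ) :
    Summable (fun k : ℕ =>
      Real.exp (-C * ((k : ℝ) + 1) ^ 2 / (((k : ℝ) + 1) + (n₀ : ℝ) + 1))) ∧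
    (∑' k : ℕ, Real.exp (-C * ((k : ℝ) + 1) ^ 2 / (((k : ℝ) + 1) + (n₀ : ℝ) + 1))) ≤
      Real.sqrt (2 * Real.pi * ((n₀ : ℝ) + 1) / C) +
        (2 / C) * Real.exp (-C * ((n₀ : ℝ) + 1) / 2) := by
  set f : ℕ → ℝ := fun k =>
    Real.exp (-C * ((k : ℝ) + 1) ^ 2 / (((k : ℝ) + 1) + (n₀ : ℝ) + 1))
  have hn : (0 : ℝ) < n₀ + 1 := by positivity
  have hhead (k : ℕ) (hk : k ∈ Finset.range (n₀ + 1)) :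
      f k ≤ Real.exp (-(C / (2 * (n₀ + 1))) * ((k : ℝ) + 1) ^ 2) := by
    have hk' : (k : ℝ) ≤ n₀ := by
      exact_mod_cast Nat.lt_succ_iff.1 (Finset.mem_range.1 hk)
    have h : C * ((k : ℝ) + 1) ^ 2 / (2 * (n₀ + 1)) ≤
        C * ((k : ℝ) + 1) ^ 2 / (((k : ℝ) + 1) + n₀ + 1) := by
      gcongr
      linarith
    refine Real.exp_le_exp.2 ?_
    rw [neg_mul, neg_div, neg_mul, div_mul_eq_mul_div]
    exact neg_le_neg h
  have htail (i : ℕ) :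
      f (i + (n₀ + 1)) ≤ Real.exp (-(C / 2) * (((n₀ : ℝ) + 1) + (i + 1))) := by
    refine Real.exp_le_exp.2 ?_
    push_cast
    have hi : (0 : ℝ) ≤ i := i.cast_nonneg
    rw [div_le_iff₀ (by positivity)]
    have h : 0 ≤ C * (((n₀ : ℝ) + 1 + (i + 1)) * (i + 1)) := by positivity
    linarith
  have hgeom := hasSum_exp_neg_mul_add_one (half_pos hC) ((n₀ : ℝ) + 1)
  have hsum_tail : Summable fun i => f (i + (n₀ + 1)) :=
    .of_nonneg_of_le (fun _ => (Real.exp_pos _).le) htail hgeom.summable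
  have hsum : Summable f := (summable_nat_add_iff (n₀ + 1)).1 hsum_tail
  refine ⟨hsum, ?_⟩
  rw [← hsum.sum_add_tsum_nat_add (n₀ + 1)]
  gcongr
  · calc ∑ k ∈ Finset.range (n₀ + 1), f k
        ≤ √(π / (C / (2 * (n₀ + 1)))) / 2 :=
          (Finset.sum_le_sum hhead).trans (sum_range_exp_neg_mul_sq_le (by positivity) _)
      _ ≤ √(π / (C / (2 * (n₀ + 1)))) := half_le_self (Real.sqrt_nonneg _)
      _ = √(2 * π * (n₀ + 1) / C) := by
          congr 1
          field_simp
  · calc ∑' i, f (i + (n₀ + 1))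
        ≤ Real.exp (-(C / 2) * ((n₀ : ℝ) + 1)) / (Real.exp (C / 2) - 1) :=
          hgeom.tsum_eq ▸ hsum_tail.tsum_le_tsum htail hgeom.summable
      _ ≤ Real.exp (-(C / 2) * ((n₀ : ℝ) + 1)) / (C / 2) := by
          gcongr
          linarith [Real.add_one_le_exp (C / 2)]
      _ = 2 / C * Real.exp (-C * ((n₀ : ℝ) + 1) / 2) := by
          rw [show -(C / 2) * ((n₀ : ℝ) + 1) = -C * ((n₀ : ℝ) + 1) / 2 by ring]
          field_simp
end

section
/- Let p and q be strictly positive, twice continuously differentiable probability densities on ℝ. For a positive C² density r, define the Hyvärinen score S_H(y; r) = ½((log r)′(y))² + (log r)″(y). Assume the integrability conditions ∫ p·((log p)′)² < ∞, ∫ p·((log q)′)² < ∞, ∫ p·|(log p)″| < ∞, ∫ p·|(log q)″| < ∞, and the boundary conditions p(y)·(log p)′(y) → 0 and p(y)·(log q)′(y) → 0 as y → ±∞. Then ∫_ℝ p(y)·[S_H(y; p) − S_H(y; q)] dy = −(1/2)·∫_ℝ p(y)·((log p)′(y) − (log q)′(y))² dy. -/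
open MeasureTheory

/-- The Hyvärinen score of a positive `C²` density `r` on `ℝ`:
`S_H(y; r) = ½((log r)′(y))² + (log r)″(y)`. -/
noncomputable def hyvarinenScore (r : ℝ → ℝ) (y : ℝ) : ℝ :=
  (1 / 2) * (deriv (fun z => Real.log (r z)) y) ^ 2 +
    deriv (deriv (fun z => Real.log (r z))) y

/-- The score `(log r)′` of a positive `C²` function is `C¹`. -/
lemma contDiff_deriv_log {r : ℝ → ℝ} (hpos : ∀ y, 0 < r y) (hr : ContDiff ℝ 2 r) :
    ContDiff ℝ 1 (deriv fun z => Real.log (r z)) := by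
  have hlog : ContDiff ℝ (1 + 1) (fun z => Real.log (r z)) := by
    rw [one_add_one_eq_two]
    exact hr.log fun y => (hpos y).ne'
  exact (contDiff_succ_iff_deriv.mp hlog).2.2

lemma integrable_mul_of_integrable_mul_abs {p f : ℝ → ℝ} (hpos : ∀ y, 0 < p y)
    (hp : Continuous p) (hf : Continuous f) (h : Integrable fun y => p y * |f y|) :
    Integrable fun y => p y * f y :=
  h.mono' (hp.mul hf).aestronglyMeasurable <| .of_forall fun y => by
    rw [Real.norm_eq_abs, abs_mul, abs_of_pos (hpos y)]

/-- Cauchy–Schwarz integrability with respect to a continuous positive weight. -/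
lemma integrable_weighted_mul {p f g : ℝ → ℝ} (hpos : ∀ y, 0 < p y)
    (hp : Continuous p) (hf : Continuous f) (hg : Continuous g)
    (hf2 : Integrable fun y => p y * f y ^ 2) (hg2 : Integrable fun y => p y * g y ^ 2) :
    Integrable fun y => p y * (f y * g y) :=
  (hf2.add hg2).mono' (hp.mul (hf.mul hg)).aestronglyMeasurable <| .of_forall fun y => by
    have hfg : |f y * g y| ≤ f y ^ 2 + g y ^ 2 := by
      rw [abs_le]
      constructor <;> nlinarith [sq_nonneg (f y + g y), sq_nonneg (f y - g y)]
    simpa [abs_mul, abs_of_pos (hpos y), mul_add] using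
      mul_le_mul_of_nonneg_left hfg (hpos y).le

/-- Integration by parts against a positive weight: `∫ p ψ′ = -∫ p (log p)′ ψ`. -/
lemma integral_mul_deriv_eq_neg_integral_score_mul {p ψ : ℝ → ℝ} (hpos : ∀ y, 0 < p y)
    (hp : Differentiable ℝ p) (hψ : Differentiable ℝ ψ)
    (hψ' : Integrable fun y => p y * deriv ψ y)
    (hscore : Integrable fun y => p y * (deriv (fun z => Real.log (p z)) y * ψ y))
    (htop : Filter.Tendsto (fun y => p y * ψ y) Filter.atTop (nhds 0))
    (hbot : Filter.Tendsto (fun y => p y * ψ y) Filter.atBot (nhds 0)) :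
    ∫ y, p y * deriv ψ y = -∫ y, p y * (deriv (fun z => Real.log (p z)) y * ψ y) := by
  have hderiv : ∀ y, HasDerivAt (fun y => p y * ψ y)
      (p y * (deriv (fun z => Real.log (p z)) y * ψ y) + p y * deriv ψ y) y := fun y => by
    have hne := (hpos y).ne'
    refine ((hp y).hasDerivAt.mul (hψ y).hasDerivAt).congr_deriv ?_
    rw [((hp y).hasDerivAt.log hne).deriv]
    field_simp
  have h := integral_of_hasDerivAt_of_tendsto hderiv (hscore.add hψ') hbot htop
  rw [integral_add hscore hψ'] at h
  linarith

/-- The expected Hyvärinen score difference under the true model `p` equals minus one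
half the Fisher divergence between `p` and `q`:
`∫ p·(S_H(·;p) − S_H(·;q)) = −½ ∫ p·((log p)′ − (log q)′)²`. -/
theorem expected_hyvarinen_score_difference
    (p q : ℝ → ℝ)
    (hp_pos : ∀ y, 0 < p y) (hq_pos : ∀ y, 0 < q y)
    (hp_smooth : ContDiff ℝ 2 p) (hq_smooth : ContDiff ℝ 2 q)
    (hp_density : ∫ y, p y = 1) (hq_density : ∫ y, q y = 1)
    (hint1 : Integrable (fun y => p y * (deriv (fun z => Real.log (p z)) y) ^ 2))
    (hint2 : Integrable (fun y => p y * (deriv (fun z => Real.log (q z)) y) ^ 2))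
    (hint3 : Integrable (fun y => p y * |deriv (deriv (fun z => Real.log (p z))) y|))
    (hint4 : Integrable (fun y => p y * |deriv (deriv (fun z => Real.log (q z))) y|))
    (hbp_top : Filter.Tendsto (fun y => p y * deriv (fun z => Real.log (p z)) y)
      Filter.atTop (nhds 0))
    (hbp_bot : Filter.Tendsto (fun y => p y * deriv (fun z => Real.log (p z)) y)
      Filter.atBot (nhds 0))
    (hbq_top : Filter.Tendsto (fun y => p y * deriv (fun z => Real.log (q z)) y)
      Filter.atTop (nhds 0))
    (hbq_bot : Filter.Tendsto (fun y => p y * deriv (fun z => Real.log (q z)) y)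
      Filter.atBot (nhds 0)) :
    (∫ y, p y * (hyvarinenScore p y - hyvarinenScore q y)) =
      -(1 / 2) * ∫ y, p y *
        (deriv (fun z => Real.log (p z)) y - deriv (fun z => Real.log (q z)) y) ^ 2 := by
  have ha := contDiff_deriv_log hp_pos hp_smooth
  have hb := contDiff_deriv_log hq_pos hq_smooth
  have hp := hp_smooth.continuous
  have hp_diff := hp_smooth.differentiable two_ne_zero
  have ha' := integrable_mul_of_integrable_mul_abs hp_pos hp (ha.continuous_deriv le_rfl) hint3
  have hb' := integrable_mul_of_integrable_mul_abs hp_pos hp (hb.continuous_deriv le_rfl) hint4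
  have haa := integrable_weighted_mul hp_pos hp ha.continuous ha.continuous hint1 hint1
  have hab := integrable_weighted_mul hp_pos hp ha.continuous hb.continuous hint1 hint2
  have hparts_p := integral_mul_deriv_eq_neg_integral_score_mul hp_pos hp_diff
    (ha.differentiable one_ne_zero) ha' haa hbp_top hbp_bot
  have hparts_q := integral_mul_deriv_eq_neg_integral_score_mul hp_pos hp_diff
    (hb.differentiable one_ne_zero) hb' hab hbq_top hbq_bot
  simp only [← pow_two] at hparts_p
  unfold hyvarinenScore
  generalize deriv (fun z => Real.log (p z)) = a at *
  generalize deriv (fun z => Real.log (q z)) = b at *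
  have hleft : ∫ y, p y * (1 / 2 * a y ^ 2 + deriv a y - (1 / 2 * b y ^ 2 + deriv b y)) =
      1 / 2 * (∫ y, p y * a y ^ 2) + (∫ y, p y * deriv a y) -
        (1 / 2 * (∫ y, p y * b y ^ 2) + ∫ y, p y * deriv b y) := by
    rw [← integral_const_mul, ← integral_const_mul, ← integral_add (hint1.const_mul _) ha',
      ← integral_add (hint2.const_mul _) hb',
      ← integral_sub ((hint1.const_mul _).fun_add ha') ((hint2.const_mul _).fun_add hb')]
    congr 1 with y
    ring
  have hright : ∫ y, p y * (a y - b y) ^ 2 =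
      (∫ y, p y * a y ^ 2) + (∫ y, p y * b y ^ 2) - 2 * ∫ y, p y * (a y * b y) := by
    rw [← integral_const_mul, ← integral_add hint1 hint2,
      ← integral_sub (hint1.fun_add hint2) (hab.const_mul _)]
    congr 1 with y
    ring
  rw [hleft, hright, hparts_p, hparts_q]
  ring
end

section
/- Let p : ℝ → ℝ be a strictly positive, twice continuously differentiable probability density and let ψ : ℝ → ℝ be continuously differentiable. Assume ∫ p·ψ² < ∞, ∫ p·((log p)′)² < ∞, ∫ p·|ψ′| < ∞, and p(y)·ψ(y) → 0 as y → ±∞. Then the score-matching objective satisfies ∫_ℝ p(y)·(1/2)·(ψ(y) − (log p)′(y))² dy = ∫_ℝ p(y)·[ (1/2)·ψ(y)² + ψ′(y) ] dy + (1/2)·∫_ℝ p(y)·((log p)′(y))² dy; that is, J(ψ) = J̃(ψ) + constant, where the constant does not depend on ψ. -/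
open MeasureTheory

/-- A weighted product is integrable as soon as both weighted squares are. -/
theorem integrable_weight_mul_mul {p f g : ℝ → ℝ} (hp : ∀ y, 0 ≤ p y)
    (hm : AEStronglyMeasurable (fun y => p y * (f y * g y)))
    (hf : Integrable (fun y => p y * f y ^ 2)) (hg : Integrable (fun y => p y * g y ^ 2)) :
    Integrable (fun y => p y * (f y * g y)) := by
  refine (hf.add hg).mono' hm (Filter.Eventually.of_forall fun y => ?_)
  have h : |f y * g y| ≤ f y ^ 2 + g y ^ 2 :=
    abs_le.2 ⟨by nlinarith [sq_nonneg (f y + g y), sq_nonneg (f y - g y)],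
      by nlinarith [sq_nonneg (f y + g y), sq_nonneg (f y - g y)]⟩
  simpa [abs_mul, abs_of_nonneg (hp y), mul_add] using mul_le_mul_of_nonneg_left h (hp y)

/-- The score-matching objective equals the surrogate objective up to a constant:
`∫ p·½(ψ − (log p)′)² = ∫ p·(½ψ² + ψ′) + ½∫ p·((log p)′)²`, where the last term does not
depend on the model `ψ`. -/
theorem score_matching_surrogate_identity
    (p ψ : ℝ → ℝ)
    (hp_pos : ∀ y, 0 < p y) (hp_smooth : ContDiff ℝ 2 p)
    (hp_density : ∫ y, p y = 1)
    (hψ : ContDiff ℝ 1 ψ)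
    (hint1 : Integrable (fun y => p y * (ψ y) ^ 2))
    (hint2 : Integrable (fun y => p y * (deriv (fun z => Real.log (p z)) y) ^ 2))
    (hint3 : Integrable (fun y => p y * |deriv ψ y|))
    (hbound_top : Filter.Tendsto (fun y => p y * ψ y) Filter.atTop (nhds 0))
    (hbound_bot : Filter.Tendsto (fun y => p y * ψ y) Filter.atBot (nhds 0)) :
    (∫ y, p y * ((1 : ℝ) / 2) * (ψ y - deriv (fun z => Real.log (p z)) y) ^ 2) =
      (∫ y, p y * (((1 : ℝ) / 2) * (ψ y) ^ 2 + deriv ψ y)) +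
        (1 / 2) * ∫ y, p y * (deriv (fun z => Real.log (p z)) y) ^ 2 := by
  have hp_diff : Differentiable ℝ p := hp_smooth.differentiable (by norm_num)
  have hψ_diff : Differentiable ℝ ψ := hψ.differentiable (by norm_num)
  have hp'_cont : Continuous (deriv p) := hp_smooth.continuous_deriv (by norm_num)
  have hψ'_cont : Continuous (deriv ψ) := hψ.continuous_deriv le_rfl
  have hscore : deriv (fun z => Real.log (p z)) = fun y => deriv p y / p y :=
    funext fun y => deriv.log (hp_diff y) (hp_pos y).ne'
  generalize deriv (fun z => Real.log (p z)) = s at hscore hint2 ⊢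
  have hs_cont : Continuous s :=
    hscore ▸ hp'_cont.div hp_diff.continuous fun y => (hp_pos y).ne'
  have hps : ∀ y, p y * s y = deriv p y := fun y => by
    rw [hscore, mul_div_cancel₀ _ (hp_pos y).ne']
  have hcross : Integrable (fun y => p y * (ψ y * s y)) :=
    integrable_weight_mul_mul (fun y => (hp_pos y).le)
      (hp_diff.continuous.mul (hψ.continuous.mul hs_cont)).aestronglyMeasurable hint1 hint2
  have hψ'_int : Integrable (fun y => p y * deriv ψ y) := by
    refine hint3.mono' (hp_diff.continuous.mul hψ'_cont).aestronglyMeasurable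
      (Filter.Eventually.of_forall fun y => ?_)
    simp [abs_of_pos (hp_pos y)]
  have hparts : (∫ y, p y * (ψ y * s y)) + ∫ y, p y * deriv ψ y = 0 := by
    rw [← integral_add hcross hψ'_int, ← sub_zero (0 : ℝ)]
    refine integral_of_hasDerivAt_of_tendsto (fun y => ?_) (hcross.add hψ'_int)
      hbound_bot hbound_top
    refine ((hp_diff y).hasDerivAt.mul (hψ_diff y).hasDerivAt).congr_deriv ?_
    rw [← hps y]
    ring
  have hleft : (∫ y, p y * ((1 : ℝ) / 2) * (ψ y - s y) ^ 2) =
      (1 / 2) * (∫ y, p y * ψ y ^ 2) - (∫ y, p y * (ψ y * s y)) +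
        (1 / 2) * ∫ y, p y * s y ^ 2 := by
    have hdiff : Integrable (fun y => (1 / 2) * (p y * ψ y ^ 2) - p y * (ψ y * s y)) :=
      (hint1.const_mul _).sub hcross
    rw [← integral_const_mul, ← integral_const_mul, ← integral_sub (hint1.const_mul _) hcross,
      ← integral_add hdiff (hint2.const_mul _)]
    congr with y
    ring
  have hright : (∫ y, p y * (((1 : ℝ) / 2) * ψ y ^ 2 + deriv ψ y)) =
      (1 / 2) * (∫ y, p y * ψ y ^ 2) + ∫ y, p y * deriv ψ y := by
    rw [← integral_const_mul, ← integral_add (hint1.const_mul _) hψ'_int]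
    congr with y
    ring
  rw [hleft, hright]
  linarith
end
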